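/- Let n > 4 and let L be the lattice ℤⁿ with bilinear form given by the D_n Gram matrix G, where G_{ii} = 2 for all i, G_{13} = G_{31} = G_{23} = G_{32} = −1, G_{i,i+1} = G_{i+1,i} = −1 for 3 ≤ i ≤ n − 1, and all other entries are 0 (in particular G_{12} = 0). Then the set of screeners of L is exactly the union of the set of roots {β ∈ L : ⟨β, β⟩ = 2} with the following 2n elements of norm squared 4: ±(e₁ + e₂), ±(e₁ − e₂), and ±(e₁ + e₂ + 2(e₃ + e₄ + ⋯ + e_j)) for each j with 3 ≤ j ≤ n; together these screeners form a copy of the C_n root system. -/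

import Mathlib

open Matrix

/-- The bilinear form `⟨x, y⟩ = xᵀ G y` on `ℤⁿ` attached to a Gram matrix `G`. -/
def gForm {n : ℕ} (G : Matrix (Fin n) (Fin n) ℤ) (x y : Fin n → ℤ) : ℤ :=
  x ⬝ᵥ (G *ᵥ y)

/-- `β ∈ ℤⁿ` is a *screener* of the lattice with Gram matrix `G` if `⟨β,β⟩` is even,
`β ∉ 2ℤⁿ`, and `⟨β,β⟩ ∣ 2⟨β,γ⟩` for every `γ`. -/
def IsScreenerM {n : ℕ} (G : Matrix (Fin n) (Fin n) ℤ) (β : Fin n → ℤ) : Prop :=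
  Even (gForm G β β) ∧ (¬ ∃ γ : Fin n → ℤ, β = (2 : ℤ) • γ) ∧
    ∀ γ : Fin n → ℤ, gForm G β β ∣ 2 * gForm G β γ

/-- The Gram matrix of the root lattice `D_n` (0-indexed): the fork ends are indices
`0, 1`, both joined to the central node `2`, which starts the chain `2 — 3 — ⋯ — n-1`;
in particular `G 0 1 = 0`. -/
def gramD (n : ℕ) : Matrix (Fin n) (Fin n) ℤ :=
  Matrix.of fun i j =>
    if i = j then 2
    else if ((i : ℕ) = 0 ∧ (j : ℕ) = 2) ∨ ((i : ℕ) = 2 ∧ (j : ℕ) = 0) ∨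
            ((i : ℕ) = 1 ∧ (j : ℕ) = 2) ∨ ((i : ℕ) = 2 ∧ (j : ℕ) = 1) ∨
            (2 ≤ (i : ℕ) ∧ (i : ℕ) + 1 = (j : ℕ)) ∨
            (2 ≤ (j : ℕ) ∧ (j : ℕ) + 1 = (i : ℕ))
      then -1 else 0

/-- The `2n` nonroot screeners of `D_n` (0-indexed): `±(e₀ + e₁)`, `±(e₀ − e₁)`, and
`±(e₀ + e₁ + 2(e₂ + ⋯ + e_j))` for `2 ≤ j ≤ n − 1`. -/
def dnExtra (n : ℕ) : Set (Fin n → ℤ) :=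
  {β | ∃ ε : ℤ, (ε = 1 ∨ ε = -1) ∧
    (β = ε • (fun k : Fin n => if (k : ℕ) ≤ 1 then (1 : ℤ) else 0) ∨
     β = ε • (fun k : Fin n =>
        if (k : ℕ) = 0 then (1 : ℤ) else if (k : ℕ) = 1 then -1 else 0) ∨
     ∃ j : ℕ, 2 ≤ j ∧ j ≤ n - 1 ∧
       β = ε • (fun k : Fin n =>
          if (k : ℕ) ≤ 1 then (1 : ℤ) else if (k : ℕ) ≤ j then 2 else 0))}

/-- The index `p i` such that the `i`-th simple root of `D_n` is `f i ± f (p i)` in an orthonormal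
basis `f`: `p 0 = 1` and `p i = i - 1` for `i ≠ 0`. -/
def dnPartner {n : ℕ} (hn : 1 < n) (i : Fin n) : Fin n :=
  ⟨if (i : ℕ) = 0 then 1 else i - 1, by split_ifs <;> omega⟩

/-- The sign with which `f (dnPartner i)` occurs in the `i`-th simple root. -/
def dnSign {n : ℕ} (i : Fin n) : ℤ := if (i : ℕ) = 0 then 1 else -1

/-- The `i`-th simple root of `D_n` in orthonormal coordinates. -/
def dnRoot {n : ℕ} (hn : 1 < n) (i : Fin n) : Fin n → ℤ :=
  Pi.single i 1 + dnSign i • Pi.single (dnPartner hn i) 1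

/-- The matrix whose columns are the simple roots of `D_n` in orthonormal coordinates. -/
def dnBasis {n : ℕ} (hn : 1 < n) : Matrix (Fin n) (Fin n) ℤ :=
  Matrix.of fun k i => dnRoot hn i k

/-- The matrix whose `k`-th column expresses twice the `k`-th orthonormal basis vector in the
simple roots of `D_n`. -/
def dnExtraMatrix (n : ℕ) : Matrix (Fin n) (Fin n) ℤ :=
  Matrix.of fun i k =>
    if (k : ℕ) = 0 then (if (i : ℕ) = 0 then 1 else if (i : ℕ) = 1 then -1 else 0)
    else if (i : ℕ) ≤ 1 then 1 else if (i : ℕ) ≤ k then 2 else 0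

lemma dotProduct_dnRoot {n : ℕ} (hn : 1 < n) (u : Fin n → ℤ) (i : Fin n) :
    u ⬝ᵥ dnRoot hn i = u i + dnSign i * u (dnPartner hn i) := by
  rw [dnRoot, dotProduct_add, dotProduct_smul, dotProduct_single_one, dotProduct_single_one,
    smul_eq_mul]

lemma dnBasis_transpose_mul_self {n : ℕ} (hn : 1 < n) :
    (dnBasis hn)ᵀ * dnBasis hn = gramD n := by
  ext i j
  change dnRoot hn i ⬝ᵥ dnRoot hn j = _
  rw [dotProduct_dnRoot]
  obtain ⟨i, hi⟩ := i
  obtain ⟨j, hj⟩ := j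
  simp only [dnRoot, dnSign, dnPartner, gramD, Pi.add_apply, Pi.smul_apply, Pi.single_apply,
    Matrix.of_apply, Fin.mk.injEq, smul_eq_mul]
  grind

lemma gForm_gramD {n : ℕ} (hn : 1 < n) (x y : Fin n → ℤ) :
    gForm (gramD n) x y = (dnBasis hn *ᵥ x) ⬝ᵥ (dnBasis hn *ᵥ y) := by
  rw [gForm, ← dnBasis_transpose_mul_self hn, ← mulVec_mulVec, dotProduct_mulVec,
    vecMul_transpose]

lemma gForm_gramD_single {n : ℕ} (hn : 1 < n) (x : Fin n → ℤ) (i : Fin n) :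
    gForm (gramD n) x (Pi.single i 1) =
      (dnBasis hn *ᵥ x) i + dnSign i * (dnBasis hn *ᵥ x) (dnPartner hn i) := by
  rw [gForm_gramD hn, ← dotProduct_dnRoot, mulVec_single_one]
  rfl

lemma dnExtraMatrix_mul_dnBasis {n : ℕ} (hn : 1 < n) :
    dnExtraMatrix n * dnBasis hn = (2 : ℤ) • (1 : Matrix (Fin n) (Fin n) ℤ) := by
  ext i j
  change dnExtraMatrix n i ⬝ᵥ dnRoot hn j = _
  rw [dotProduct_dnRoot]
  obtain ⟨i, hi⟩ := i
  obtain ⟨j, hj⟩ := j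
  simp only [dnExtraMatrix, dnSign, dnPartner, Matrix.of_apply, Matrix.smul_apply,
    Matrix.one_apply, Fin.mk.injEq, smul_eq_mul]
  grind

lemma dnExtraMatrix_mulVec_dnBasis_mulVec {n : ℕ} (hn : 1 < n) (x : Fin n → ℤ) :
    dnExtraMatrix n *ᵥ (dnBasis hn *ᵥ x) = (2 : ℤ) • x := by
  rw [mulVec_mulVec, dnExtraMatrix_mul_dnBasis, smul_mulVec, one_mulVec]

lemma dnBasis_mulVec_injective {n : ℕ} (hn : 1 < n) :
    Function.Injective fun x => dnBasis hn *ᵥ x := by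
  intro x y h
  have h2 := congrArg (dnExtraMatrix n *ᵥ ·) h
  simp only [dnExtraMatrix_mulVec_dnBasis_mulVec] at h2
  exact smul_right_injective _ two_ne_zero h2

lemma dnBasis_mulVec_dnExtraMatrix_col {n : ℕ} (hn : 1 < n) (k : Fin n) :
    dnBasis hn *ᵥ (dnExtraMatrix n).col k = Pi.single k 2 := by
  have hdet : (dnExtraMatrix n).det ≠ 0 := by
    intro h
    have h2 := congrArg det (dnExtraMatrix_mul_dnBasis hn)
    rw [det_mul, h, zero_mul, det_smul, det_one, mul_one] at h2
    exact pow_ne_zero _ two_ne_zero h2.symm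
  refine sub_eq_zero.1 (eq_zero_of_mulVec_eq_zero hdet ?_)
  rw [mulVec_sub, dnExtraMatrix_mulVec_dnBasis_mulVec, mulVec_single]
  ext i
  simp [mul_comm]

lemma mem_dnExtra_iff {n : ℕ} (hn : 1 < n) (β : Fin n → ℤ) :
    β ∈ dnExtra n ↔
      ∃ ε : ℤ, (ε = 1 ∨ ε = -1) ∧ ∃ k, β = ε • (dnExtraMatrix n).col k := by
  refine exists_congr fun ε => and_congr_right fun _ => ⟨?_, ?_⟩
  · rintro (rfl | rfl | ⟨j, hj, hjn, rfl⟩)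
    · refine ⟨⟨1, hn⟩, congrArg _ (funext fun i => ?_)⟩
      simp only [dnExtraMatrix, Matrix.col_apply, Matrix.of_apply]
      grind
    · refine ⟨⟨0, by omega⟩, congrArg _ (funext fun i => ?_)⟩
      simp [dnExtraMatrix]
    · refine ⟨⟨j, by omega⟩, congrArg _ (funext fun i => ?_)⟩
      simp only [dnExtraMatrix, Matrix.col_apply, Matrix.of_apply]
      grind
  · rintro ⟨⟨k, hk⟩, rfl⟩
    obtain rfl | rfl | h : k = 0 ∨ k = 1 ∨ 2 ≤ k := by omega
    · refine Or.inr (Or.inl (congrArg _ (funext fun i => ?_)))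
      simp [dnExtraMatrix]
    · refine Or.inl (congrArg _ (funext fun i => ?_))
      simp only [dnExtraMatrix, Matrix.col_apply, Matrix.of_apply]
      grind
    · refine Or.inr (Or.inr ⟨k, h, by omega, congrArg _ (funext fun i => ?_)⟩)
      simp only [dnExtraMatrix, Matrix.col_apply, Matrix.of_apply]
      grind

lemma mem_dnExtra_iff_dnBasis_mulVec {n : ℕ} (hn : 1 < n) (β : Fin n → ℤ) :
    β ∈ dnExtra n ↔
      ∃ ε : ℤ, (ε = 1 ∨ ε = -1) ∧ ∃ k, dnBasis hn *ᵥ β = Pi.single k (2 * ε) := by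
  rw [mem_dnExtra_iff hn]
  refine exists_congr fun ε => and_congr_right fun _ => exists_congr fun k => ?_
  rw [← (dnBasis_mulVec_injective hn).eq_iff]
  simp only [mulVec_smul, dnBasis_mulVec_dnExtraMatrix_col, ← Pi.single_smul, smul_eq_mul,
    mul_comm]

lemma gForm_gramD_self_of_mem_dnExtra {n : ℕ} (hn : 1 < n) {β : Fin n → ℤ}
    (hβ : β ∈ dnExtra n) : gForm (gramD n) β β = 4 := by
  obtain ⟨ε, hε, k, h⟩ := (mem_dnExtra_iff_dnBasis_mulVec hn β).1 hβ
  rw [gForm_gramD hn, h, single_dotProduct, Pi.single_eq_same]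
  obtain rfl | rfl := hε <;> norm_num

lemma gForm_two_smul {n : ℕ} (G : Matrix (Fin n) (Fin n) ℤ) (γ : Fin n → ℤ) :
    gForm G ((2 : ℤ) • γ) ((2 : ℤ) • γ) = 4 * gForm G γ γ := by
  simp only [gForm, mulVec_smul, smul_dotProduct, dotProduct_smul, smul_eq_mul]
  ring

lemma isScreenerM_of_gForm_self_eq_two {n : ℕ} {G : Matrix (Fin n) (Fin n) ℤ} {β : Fin n → ℤ}
    (h : gForm G β β = 2) : IsScreenerM G β := by
  refine ⟨h ▸ even_two, ?_, fun γ => h ▸ dvd_mul_right _ _⟩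
  rintro ⟨γ, rfl⟩
  rw [gForm_two_smul] at h
  omega

lemma isScreenerM_of_mem_dnExtra {n : ℕ} (hn : 1 < n) {β : Fin n → ℤ} (hβ : β ∈ dnExtra n) :
    IsScreenerM (gramD n) β := by
  have h4 := gForm_gramD_self_of_mem_dnExtra hn hβ
  refine ⟨h4 ▸ by decide, ?_, fun γ => ?_⟩
  · rintro ⟨γ, rfl⟩
    obtain ⟨ε, hε, k, h⟩ := (mem_dnExtra_iff hn _).1 hβ
    have h0 := congrFun h ⟨0, by omega⟩
    simp only [dnExtraMatrix, Pi.smul_apply, Matrix.col_apply, Matrix.of_apply] at h0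
    simp only [smul_eq_mul, if_true, zero_le, ite_self, mul_one] at h0
    omega
  · obtain ⟨ε, -, k, h⟩ := (mem_dnExtra_iff_dnBasis_mulVec hn β).1 hβ
    rw [h4, gForm_gramD hn, h, single_dotProduct]
    exact ⟨ε * (dnBasis hn *ᵥ γ) k, by ring⟩

/-- If the norm of an integer vector with at least five coordinates divides twice all sums and
differences of its coordinates, then it has norm at most `2` or is `±2` times a unit vector. -/
lemma exists_eq_single_of_dvd {n : ℕ} (hn : 4 < n) {u : Fin n → ℤ} (hu : u ≠ 0)
    (hsub : ∀ i j, u ⬝ᵥ u ∣ 2 * (u i - u j)) (hfour : ∀ i, u ⬝ᵥ u ∣ 4 * u i) :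
    u ⬝ᵥ u ≤ 2 ∨ ∃ ε : ℤ, (ε = 1 ∨ ε = -1) ∧ ∃ k, u = Pi.single k (2 * ε) := by
  have hsq : u ⬝ᵥ u = ∑ i, u i ^ 2 := by simp [dotProduct, sq]
  obtain ⟨i, hi⟩ : ∃ i, u i = 0 := by
    by_contra! hne
    have hone (i : Fin n) : 1 ≤ u i ^ 2 :=
      Int.add_one_le_of_lt (sq_pos_of_ne_zero (hne i))
    have hle (i : Fin n) : u ⬝ᵥ u ≤ 4 * |u i| := by
      have := Int.le_of_dvd (by have := hne i; positivity) ((dvd_abs _ _).2 (hfour i))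
      rwa [abs_mul, abs_of_pos four_pos] at this
    have hge (i : Fin n) : u i ^ 2 + 4 ≤ u ⬝ᵥ u := by
      have hcard : (Finset.univ.erase i).card • (1 : ℤ) ≤ ∑ j ∈ Finset.univ.erase i, u j ^ 2 :=
        Finset.card_nsmul_le_sum _ _ _ fun j _ => hone j
      rw [Finset.card_erase_of_mem (Finset.mem_univ i), Finset.card_univ, Fintype.card_fin,
        nsmul_eq_mul, mul_one] at hcard
      rw [hsq, ← Finset.add_sum_erase _ (fun j => u j ^ 2) (Finset.mem_univ i)]
      omega
    have habs (i : Fin n) : |u i| = 2 := by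
      nlinarith [hle i, hge i, sq_abs (u i), sq_nonneg (|u i| - 2)]
    have hsum : u ⬝ᵥ u = n * 4 := by
      rw [hsq, Finset.sum_congr rfl fun i _ => by rw [← sq_abs, habs i]]
      simp
    have := hle ⟨0, by omega⟩
    rw [habs] at this
    omega
  obtain ⟨k, hk⟩ := Function.ne_iff.1 hu
  have hk : u k ≠ 0 := hk
  have hle : u ⬝ᵥ u ≤ 2 * |u k| := by
    have := hsub k i
    rw [hi, sub_zero] at this
    have := Int.le_of_dvd (by positivity) ((dvd_abs _ _).2 this)
    rwa [abs_mul, abs_of_pos two_pos] at this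
  have hsplit : u k ^ 2 + ∑ j ∈ Finset.univ.erase k, u j ^ 2 = u ⬝ᵥ u := by
    rw [hsq, Finset.add_sum_erase _ (fun j => u j ^ 2) (Finset.mem_univ k)]
  have hrest : 0 ≤ ∑ j ∈ Finset.univ.erase k, u j ^ 2 := Finset.sum_nonneg fun j _ => sq_nonneg _
  have hpos : 0 < |u k| := abs_pos.2 hk
  have hle2 : |u k| ≤ 2 := by nlinarith [sq_abs (u k)]
  obtain h1 | h2 : |u k| = 1 ∨ |u k| = 2 := by omega
  · exact Or.inl (by omega)
  · have hrest0 : ∑ j ∈ Finset.univ.erase k, u j ^ 2 = 0 := by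
      have := sq_abs (u k)
      rw [h2] at this
      linarith
    have hzero (j : Fin n) (hj : j ≠ k) : u j = 0 :=
      pow_eq_zero_iff two_ne_zero |>.1 <|
        (Finset.sum_eq_zero_iff_of_nonneg fun j _ => sq_nonneg (u j)).1 hrest0 j (by simp [hj])
    have hsingle : u = Pi.single k (u k) := by
      ext j
      obtain rfl | hj := eq_or_ne j k
      · simp
      · simp [hj, hzero j hj]
    rw [abs_eq two_pos.le] at h2
    obtain h2 | h2 := h2
    · exact Or.inr ⟨1, Or.inl rfl, k, by rw [hsingle, h2]; simp⟩
    · exact Or.inr ⟨-1, Or.inr rfl, k, by rw [hsingle, h2]; simp⟩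

lemma IsScreenerM.gForm_eq_two_or_mem_dnExtra {n : ℕ} (hn : 4 < n) {β : Fin n → ℤ}
    (hβ : IsScreenerM (gramD n) β) : gForm (gramD n) β β = 2 ∨ β ∈ dnExtra n := by
  have hn1 : 1 < n := by omega
  obtain ⟨heven, hprim, hdvd⟩ := hβ
  rw [mem_dnExtra_iff_dnBasis_mulVec hn1]
  have hdvd' (i : Fin n) := gForm_gramD_single hn1 β i ▸ hdvd (Pi.single i 1)
  rw [gForm_gramD hn1] at heven hdvd' ⊢
  have hu : dnBasis hn1 *ᵥ β ≠ 0 := by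
    intro h
    refine hprim ⟨0, dnBasis_mulVec_injective hn1 ?_⟩
    simp [h]
  set u := dnBasis hn1 *ᵥ β
  have hzero (k : ℕ) (hk : k < n) : u ⬝ᵥ u ∣ 2 * (u ⟨k, hk⟩ - u ⟨0, by omega⟩) := by
    induction k with
    | zero => simp
    | succ k ih =>
      obtain ⟨a, ha⟩ := ih (by omega)
      obtain ⟨b, hb⟩ := hdvd' ⟨k + 1, hk⟩
      simp only [dnSign, dnPartner, Nat.add_eq_zero_iff, one_ne_zero, and_false, if_false,
        Nat.add_sub_cancel] at hb
      exact ⟨a + b, by linear_combination ha + hb⟩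
  have hsub (i j : Fin n) : u ⬝ᵥ u ∣ 2 * (u i - u j) := by
    obtain ⟨a, ha⟩ := hzero i i.2
    obtain ⟨b, hb⟩ := hzero j j.2
    exact ⟨a - b, by linear_combination ha - hb⟩
  have hfour (i : Fin n) : u ⬝ᵥ u ∣ 4 * u i := by
    obtain ⟨a, ha⟩ := hdvd' ⟨0, by omega⟩
    obtain ⟨b, hb⟩ := hsub i ⟨0, by omega⟩
    obtain ⟨c, hc⟩ := hsub i ⟨1, hn1⟩
    simp only [dnSign, dnPartner, if_true] at ha
    exact ⟨a + b + c, by linear_combination ha + hb + hc⟩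
  refine (exists_eq_single_of_dvd hn hu hsub hfour).imp_left fun hle => ?_
  have hnonneg : 0 ≤ u ⬝ᵥ u := Finset.sum_nonneg fun i _ => mul_self_nonneg _
  have hne : u ⬝ᵥ u ≠ 0 := mt dotProduct_self_eq_zero.1 hu
  obtain ⟨m, hm⟩ := heven
  omega

/-- For `n > 4`, the screeners of `D_n` are exactly its roots (norm
squared 2) together with the `2n` nonroot screeners of norm squared 4 listed in
`dnExtra n` (forming `C_n`). -/
theorem screeners_of_Dn
    (n : ℕ) (hn : 4 < n) :
    (∀ β : Fin n → ℤ, IsScreenerM (gramD n) β ↔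
        (gForm (gramD n) β β = 2 ∨ β ∈ dnExtra n)) ∧
    (∀ β ∈ dnExtra n, gForm (gramD n) β β = 4) := by
  have hn1 : 1 < n := by omega
  exact ⟨fun β => ⟨fun h => h.gForm_eq_two_or_mem_dnExtra hn,
    fun h => h.elim isScreenerM_of_gForm_self_eq_two (isScreenerM_of_mem_dnExtra hn1)⟩,
    fun β hβ => gForm_gramD_self_of_mem_dnExtra hn1 hβ⟩
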